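/- (Invariance of seeing under taking one's own perspective, the key step in the paper's proof of axioms 4 and 5) For every choice of variable type V, value type D, agent type A, family of perspective functions f, state s, agent i, and epistemic formula φ: f i s ⊨ S i φ if and only if s ⊨ S i φ. (This follows from idempotence of the perspective function, f i (f i s) = f i s.) -/

import Mathlib

/-- Epistemic formulas: atoms (a list of variables with a predicate on their values),
negation, conjunction, seeing `S i φ`, and knowledge `K i φ`. -/
inductive Formula (V D A : Type) where
  | atom : List V → (List D → Prop) → Formula V D A
  | neg : Formula V D A → Formula V D A
  | conj : Formula V D A → Formula V D A → Formula V D A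
  | see : A → Formula V D A → Formula V D A
  | know : A → Formula V D A → Formula V D A

/-- Implication `φ → ψ` abbreviates `¬(φ ∧ ¬ψ)`. -/
def Formula.imp {V D A : Type} (φ ψ : Formula V D A) : Formula V D A :=
  .neg (.conj φ (.neg ψ))

/-- `s' ⊑ s`: the partial assignment `s'` is a restriction of `s`. -/
def SubState {V D : Type} (s' s : V → Option D) : Prop :=
  ∀ v d, s' v = some d → s v = some d

/-- A family of perspective functions: for each agent a contracting, idempotent
map on partial states. -/
structure Perspective (V D A : Type) where
  f : A → (V → Option D) → (V → Option D)
  sub : ∀ i s, SubState (f i s) s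
  idem : ∀ i s, f i (f i s) = f i s

/-- A weight used to justify termination of the satisfaction relation. -/
def Formula.w {V D A : Type} : Formula V D A → Nat
  | .atom _ _ => 1
  | .neg φ => φ.w + 1
  | .conj φ ψ => φ.w + ψ.w + 1
  | .see _ φ => φ.w + 1
  | .know _ φ => φ.w + 2

/-- Satisfaction of an epistemic formula at a state, relative to a family of
perspective functions. -/
def Sat {V D A : Type} (P : Perspective V D A) :
    (V → Option D) → Formula V D A → Prop
  | s, .atom vs R => ∃ ds, vs.mapM s = some ds ∧ R ds
  | s, .neg φ => ¬ Sat P s φ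
  | s, .conj φ ψ => Sat P s φ ∧ Sat P s ψ
  | s, .see i (.atom vs _) => ∃ ds, vs.mapM (P.f i s) = some ds
  | s, .see i (.neg φ) => Sat P s (.see i φ)
  | s, .see i (.conj φ ψ) => Sat P s (.see i φ) ∧ Sat P s (.see i ψ)
  | s, .see i (.see j φ) => Sat P (P.f i s) (.see j φ)
  | s, .see i (.know j φ) => Sat P (P.f i s) (.know j φ)
  | s, .know i φ => Sat P s φ ∧ Sat P s (.see i φ)
  termination_by _ φ => φ.w
  decreasing_by all_goals (simp [Formula.w]; try omega)

/-- Invariance of seeing under taking one's own perspective: the key step in the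
paper's proof of axioms 4 and 5. -/
theorem see_perspective_invariant (V D A : Type) (P : Perspective V D A)
    (s : V → Option D) (i : A) (φ : Formula V D A) :
    Sat P (P.f i s) (.see i φ) ↔ Sat P s (.see i φ) := by
  induction φ with
  | atom vs R => simp only [Sat, P.idem]
  | neg φ ih => simpa only [Sat] using ih
  | conj φ ψ ihφ ihψ => simp only [Sat, ihφ, ihψ]
  | see j φ _ => rw [Sat, Sat, P.idem]
  | know j φ _ => rw [Sat.eq_def P _ (.see i _), Sat.eq_def P s]; simp only [P.idem]
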